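/- Deviation bound via conditional Chernoff bounds: in the bandit model with rewards in {1,...,k}, fix for each arm x ∈ X and each r ∈ {1,...,k−1} numbers N̄′(r,x) ∈ {0,...,t}, signs y(r,x) ∈ {−1,+1}, a parameter η > 0, and targets Q′(r,x) ∈ [0,1] satisfying Q′(r,x)·y(r,x) ≤ P′(r,x)·y(r,x). Let B be the event that N̄′(r,x) ≤ N′_t(r,x) ≤ (1+η)·N̄′(r,x) for all x ∈ X and r ∈ {1,...,k−1}, and let C be the event that P′_t(r,x)·y(r,x) ≤ Q′(r,x)·y(r,x) for all x ∈ X and r ∈ {1,...,k−1}. Then Prob(B ∩ C) ≤ Π_{x∈X} Π_{r=1}^{k−1} exp(−N̄′(r,x)·I_B(Q′(r,x),P′(r,x))). -/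

import Mathlib

open scoped BigOperators Classical ENNReal
open MeasureTheory

namespace Bandit

section Table

variable {R X : Type*} [Fintype R] [Fintype X] [Nonempty X] [Nonempty R]
  [DecidableEq R] [DecidableEq X]

/-- The probability measure on reward tables `ω : Fin T → X → R` (the reward `ω t x` of arm
`x` in round `t+1`), given by the product of the reward distributions `P(·, x)`:
independent rewards across arms and rounds. -/
noncomputable def tableMeasure (P : R → X → ℝ) (T : ℕ) :
    @Measure (Fin T → X → R) ⊤ :=
  ∑ ω : Fin T → X → R,
    (∏ t : Fin T, ∏ x : X, ENNReal.ofReal (P (ω t x) x)) • @Measure.dirac _ ⊤ ω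

/-- The history `(x₁, R₁(x₁), …, xₙ, Rₙ(xₙ))` of the first `n` rounds, for a policy
`π` choosing the arm of each round measurably from the past history. -/
def histT (π : List (X × R) → X) {T : ℕ} (ω : Fin T → X → R) : ℕ → List (X × R)
  | 0 => []
  | n + 1 =>
    if hn : n < T then
      histT π ω n ++ [(π (histT π ω n), ω ⟨n, hn⟩ (π (histT π ω n)))]
    else histT π ω n

/-- `N_t(x)`: the number of pulls of arm `x` before round `t`. -/
def pullsT (π : List (X × R) → X) {T : ℕ} (ω : Fin T → X → R) (t : ℕ) (x : X) : ℕ :=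
  ((histT π ω (t - 1)).filter fun p => p.1 = x).length

/-- `P_t(r, x)`: the empirical probability of reward `r` on arm `x` before round `t`. -/
noncomputable def empT (π : List (X × R) → X) {T : ℕ} (ω : Fin T → X → R)
    (t : ℕ) (r : R) (x : X) : ℝ :=
  (((histT π ω (t - 1)).filter fun p => p = (x, r)).length : ℝ) / pullsT π ω t x

end Table

end Bandit

namespace Bandit

section Dev

variable {X : Type*} [Fintype X] [Nonempty X] [DecidableEq X] {k : ℕ} [NeZero k]

/-- `N′_t(r, x)`: the number of times before round `t` that arm `x` was pulled and the
observed reward was at least `r`. -/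
def pullsGeT (π : List (X × Fin k) → X) {T : ℕ} (ω : Fin T → X → Fin k)
    (t : ℕ) (r : Fin k) (x : X) : ℕ :=
  ((histT π ω (t - 1)).filter fun p => p.1 = x ∧ r ≤ p.2).length

/-- `N_t(r, x)`: the number of times before round `t` that arm `x` was pulled and the
observed reward was exactly `r`. -/
def pullsEqT (π : List (X × Fin k) → X) {T : ℕ} (ω : Fin T → X → Fin k)
    (t : ℕ) (r : Fin k) (x : X) : ℕ :=
  ((histT π ω (t - 1)).filter fun p => p = (x, r)).length

/-- `P′(r, x) = P(r,x) / Σ_{r′ ≥ r} P(r′,x)`: the conditional probability of reward exactly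
`r` given reward at least `r`. -/
noncomputable def PcondT (P : Fin k → X → ℝ) (r : Fin k) (x : X) : ℝ :=
  P r x / ∑ r' ∈ Finset.univ.filter (fun r' : Fin k => r ≤ r'), P r' x

/-- `P′_t(r, x) = N_t(r,x)/N′_t(r,x)`: the empirical conditional probability. -/
noncomputable def PcondEmpT (π : List (X × Fin k) → X) {T : ℕ} (ω : Fin T → X → Fin k)
    (t : ℕ) (r : Fin k) (x : X) : ℝ :=
  (pullsEqT π ω t r x : ℝ) / (pullsGeT π ω t r x : ℝ)

end Dev

/-- Bernoulli information distance `I_B(p, q)`. -/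
noncomputable def klBern (p q : ℝ) : EReal :=
  if ∀ b : Bool, (if b then q else 1 - q) = 0 → (if b then p else 1 - p) = 0 then
    ((p * Real.log (p / q) + (1 - p) * Real.log ((1 - p) / (1 - q)) : ℝ) : EReal)
  else ⊤

/-- `exp(−a)` for an extended-real `a` (with `exp(−∞·) = 0` at `a = ⊤`), valued in `ℝ≥0∞`. -/
noncomputable def expNegE (a : EReal) : ℝ≥0∞ :=
  if a = ⊤ then 0 else ENNReal.ofReal (Real.exp (-a.toReal))

/-- The weight `a r` of a reward equal to `r`, `b r` of a reward above `r`, and `1` below `r`. -/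
noncomputable def rewardWeight {k : ℕ} (a b : Fin k → ℝ≥0∞) (j r : Fin k) : ℝ≥0∞ :=
  if j = r then a r else if r < j then b r else 1

/-- If conditionally on a reward at least `r` the `r`-th weight has mean at most one, then the
product of all the weights has mean at most one. -/
theorem sum_mul_prod_rewardWeight_le {k : ℕ} (u a b : Fin k → ℝ≥0∞)
    (h : ∀ r, u r * a r + (∑ j, if r < j then u j else 0) * b r ≤
      ∑ j, if r ≤ j then u j else 0) :
    ∑ j, u j * ∏ r, rewardWeight a b j r ≤ ∑ j, u j := by
  induction k with
  | zero => simp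
  | succ k ih =>
    have h0 := h 0
    have ih' := ih (fun i => u i.succ) (fun i => a i.succ) (fun i => b i.succ) (by
      intro r
      have := h r.succ
      simpa [Fin.sum_univ_succ] using this)
    simp only [Fin.sum_univ_succ, Fin.prod_univ_succ, rewardWeight] at h0 ih' ⊢
    simp only [lt_self_iff_false, ↓reduceIte, Fin.succ_pos, zero_add, Fin.zero_le,
      Fin.succ_ne_zero, Fin.succ_inj, Fin.succ_lt_succ_iff, Fin.not_lt_zero,
      (Fin.succ_ne_zero _).symm, Finset.prod_const_one, mul_one] at h0 ih' ⊢
    refine le_trans ?_ h0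
    gcongr
    rw [Finset.sum_mul]
    calc _ = (∑ i : Fin k, u i.succ * ∏ r : Fin k, if i = r then a r.succ
              else if r < i then b r.succ else 1) * b 0 := by
            rw [Finset.sum_mul]
            exact Finset.sum_congr rfl fun i _ => by ring
      _ ≤ (∑ i : Fin k, u i.succ) * b 0 := by gcongr
      _ = _ := by rw [Finset.sum_mul]

section Table

variable {R X : Type*}

/-- The history of a table splits into its first round and the history of the later rounds. -/
theorem histT_cons (π : List (X × R) → X) {T : ℕ} (v : X → R) (ω : Fin T → X → R) (n : ℕ) :
    histT π (Fin.cons v ω : Fin (T + 1) → X → R) (n + 1) =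
      (π [], v (π [])) :: histT (fun l => π ((π [], v (π [])) :: l)) ω n := by
  induction n with
  | zero => simp [histT]
  | succ n ih =>
    rw [histT, ih, histT]
    by_cases hn : n < T
    · have hc : (Fin.cons v ω : Fin (T + 1) → X → R) ⟨n + 1, Nat.succ_lt_succ hn⟩ = ω ⟨n, hn⟩ :=
        Fin.cons_succ (α := fun _ => X → R) v ω ⟨n, hn⟩
      simp [hn, hc]
    · simp [hn]

variable [Fintype R] [Fintype X]

theorem sum_table_mul_prod_histT_le [DecidableEq X] (u : R → X → ℝ≥0∞) (hu : ∀ x, ∑ j, u j x = 1)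
    (W : X × R → ℝ≥0∞) (hW : ∀ x, ∑ j, u j x * W (x, j) ≤ 1) (T n : ℕ)
    (π : List (X × R) → X) :
    ∑ ω : Fin T → X → R, (∏ t, ∏ x, u (ω t x) x) * ((histT π ω n).map W).prod ≤ 1 := by
  induction T generalizing n π with
  | zero =>
    have h : ∀ ω : Fin 0 → X → R, histT π ω n = [] := by
      intro ω
      induction n with
      | zero => rfl
      | succ n ih => simp [histT, ih]
    simp [h]
  | succ T ih =>
    rw [← (Fin.consEquiv fun _ => X → R).sum_comp, Fintype.sum_prod_type]
    have hmass : ∀ c : X → R → ℝ≥0∞,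
        ∑ v : X → R, ∏ x, (u (v x) x * c x (v x)) = ∏ x, ∑ j, u j x * c x j := by
      intro c
      rw [Finset.prod_univ_sum]
      simp
    have key : ∀ v : X → R, ∑ ω : Fin T → X → R,
        (∏ t, ∏ x, u ((Fin.cons v ω : Fin (T + 1) → X → R) t x) x) *
          ((histT π (Fin.cons v ω : Fin (T + 1) → X → R) n).map W).prod ≤
        ∏ x, (u (v x) x * if x = π [] ∧ n ≠ 0 then W (x, v x) else 1) := by
      intro v
      simp only [Fin.prod_univ_succ, Fin.cons_zero, Fin.cons_succ, Finset.prod_mul_distrib]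
      cases n with
      | zero =>
        have := ih 0 π
        simp only [histT, List.map_nil, List.prod_nil, mul_one] at this ⊢
        rw [← Finset.mul_sum]
        simpa using mul_le_mul_right this (∏ x, u (v x) x)
      | succ n =>
        have := ih n (fun l => π ((π [], v (π [])) :: l))
        simp only [histT_cons, List.map_cons, List.prod_cons]
        simp only [ne_eq, Nat.add_eq_zero_iff, one_ne_zero, and_false, not_false_eq_true,
          and_true, Finset.prod_ite_eq', Finset.mem_univ, if_true]
        calc _ = ((∏ x, u (v x) x) * W (π [], v (π []))) *
                ∑ ω : Fin T → X → R, (∏ t, ∏ x, u (ω t x) x) *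
                  ((histT (fun l => π ((π [], v (π [])) :: l)) ω n).map W).prod := by
              rw [Finset.mul_sum]
              exact Finset.sum_congr rfl fun ω _ => by ring
          _ ≤ _ := mul_le_of_le_one_right' this
    refine (Finset.sum_le_sum fun v _ => key v).trans ?_
    rw [hmass fun x j => if x = π [] ∧ n ≠ 0 then W (x, j) else 1]
    refine Finset.prod_le_one' fun x _ => ?_
    by_cases hx : x = π [] ∧ n ≠ 0
    · simpa [hx] using hW (π [])
    · simp [hx, hu]

theorem tableMeasure_apply [Nonempty X] [Nonempty R] [DecidableEq R] [DecidableEq X]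
    (P : R → X → ℝ) (T : ℕ) (E : Set (Fin T → X → R)) :
    tableMeasure P T E = ∑ ω : Fin T → X → R,
      (∏ t, ∏ x, ENNReal.ofReal (P (ω t x) x)) * E.indicator 1 ω := by
  let : MeasurableSpace (Fin T → X → R) := ⊤
  simp only [tableMeasure, Measure.finsetSum_apply, Measure.smul_apply, smul_eq_mul]
  exact Finset.sum_congr rfl fun ω _ => by
    rw [Measure.dirac_apply' _ MeasurableSpace.measurableSet_top]

end Table

theorem prod_map_rewardWeight {X : Type*} [Fintype X] [DecidableEq X] {k : ℕ}
    (a b : X → Fin k → ℝ≥0∞) (l : List (X × Fin k)) :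
    (l.map fun p => ∏ r, rewardWeight (a p.1) (b p.1) p.2 r).prod =
      ∏ x, ∏ r, (a x r ^ (l.filter fun p => p = (x, r)).length *
        b x r ^ (l.filter fun p => p.1 = x ∧ r < p.2).length) := by
  induction l with
  | nil => simp
  | cons p l ih =>
    rw [List.map_cons, List.prod_cons, ih]
    have h1 : ∏ r, rewardWeight (a p.1) (b p.1) p.2 r =
        ∏ x, if x = p.1 then ∏ r, rewardWeight (a x) (b x) p.2 r else 1 := by simp
    rw [h1, ← Finset.prod_mul_distrib]
    refine Finset.prod_congr rfl fun x _ => ?_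
    obtain ⟨z, j⟩ := p
    by_cases hx : x = z
    · subst hx
      rw [if_pos rfl, ← Finset.prod_mul_distrib]
      refine Finset.prod_congr rfl fun r _ => ?_
      rcases lt_trichotomy j r with h | h | h
      · simp [rewardWeight, h.ne, h.not_gt]
      · subst h
        simp [rewardWeight, pow_succ]
        ring
      · simp [rewardWeight, h, h.ne', pow_succ]
        ring
    · have hx' : z ≠ x := fun h => hx h.symm
      simp [hx, hx']

theorem length_filter_ge {X : Type*} [DecidableEq X] {k : ℕ} (l : List (X × Fin k))
    (x : X) (r : Fin k) :
    (l.filter fun p => p.1 = x ∧ r ≤ p.2).length =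
      (l.filter fun p => p = (x, r)).length +
        (l.filter fun p => p.1 = x ∧ r < p.2).length := by
  induction l with
  | nil => simp
  | cons p l ih =>
    obtain ⟨z, j⟩ := p
    by_cases hx : z = x
    · subst hx
      rcases lt_trichotomy j r with h | h | h
      · simpa [List.filter_cons, h.ne, h.not_gt, h.not_ge] using ih
      · subst h
        simp at ih ⊢
        omega
      · simp [h, h.ne', h.le] at ih ⊢
        omega
    · simpa [List.filter_cons, hx] using ih

theorem sub_le_mul_log_div {p q : ℝ} (hp : 0 ≤ p) (hq : 0 < q) :
    p - q ≤ p * Real.log (p / q) := by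
  rcases hp.eq_or_lt with rfl | hp
  · simp [hq.le]
  · have h := Real.one_sub_inv_le_log_of_pos (div_pos hp hq)
    have := mul_le_mul_of_nonneg_left h hp.le
    rw [inv_div, mul_sub, mul_one, mul_div_cancel₀ _ hp.ne'] at this
    exact this

/-- The likelihood ratio of a sample dominates the Chernoff exponent as soon as the empirical
mean is at least as far from `p` as `Q`, on the side of `Q`. -/
theorem exp_mul_kl_le_likelihood {p Q y : ℝ} (hp0 : 0 < p) (hp1 : p < 1) (hQ0 : 0 ≤ Q)
    (hQ1 : Q ≤ 1) (hy : y = 1 ∨ y = -1) (hQy : Q * y ≤ p * y) {M n m : ℕ} (hM : M ≠ 0)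
    (hMn : M ≤ n + m) (he : (n : ℝ) / ((n + m : ℕ) : ℝ) * y ≤ Q * y) :
    Real.exp (M * (Q * Real.log (Q / p) + (1 - Q) * Real.log ((1 - Q) / (1 - p)))) ≤
      (Q / p) ^ n * ((1 - Q) / (1 - p)) ^ m := by
  have hp1' : 0 < 1 - p := by linarith
  have hN : (0 : ℝ) < ((n + m : ℕ) : ℝ) := by exact_mod_cast (by omega)
  have hkl : 0 ≤ Q * Real.log (Q / p) + (1 - Q) * Real.log ((1 - Q) / (1 - p)) := by
    linarith [sub_le_mul_log_div hQ0 hp0, sub_le_mul_log_div (sub_nonneg.2 hQ1) hp1']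
  have hn : Q = 0 → n = 0 := by
    rintro rfl
    rcases hy with rfl | rfl
    · rw [mul_one, zero_mul, div_le_iff₀ hN, zero_mul] at he
      exact_mod_cast le_antisymm he (Nat.cast_nonneg n)
    · linarith
  have hm : Q = 1 → m = 0 := by
    rintro rfl
    rcases hy with rfl | rfl
    · linarith
    · have h1 : 1 ≤ (n : ℝ) / ((n + m : ℕ) : ℝ) := by linarith
      rw [le_div_iff₀ hN] at h1
      push_cast at h1
      exact_mod_cast le_antisymm (by linarith : (m : ℝ) ≤ 0) (Nat.cast_nonneg m)
  have hpow : ∀ (c : ℝ) (i : ℕ), 0 ≤ c → (c = 0 → i = 0) → c ^ i = Real.exp (i * Real.log c) := by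
    intro c i hc hi
    rcases hc.eq_or_lt with rfl | hc
    · simp [hi rfl]
    · rw [mul_comm, Real.exp_mul, Real.exp_log hc, Real.rpow_natCast]
  rw [hpow (Q / p) n (by positivity) (fun h => hn (by simpa [hp0.ne'] using h)),
    hpow ((1 - Q) / (1 - p)) m (div_nonneg (by linarith) hp1'.le)
      (fun h => hm (by
        rw [div_eq_zero_iff, or_iff_left hp1'.ne'] at h
        linarith)), ← Real.exp_add, Real.exp_le_exp]
  set α := Real.log (Q / p) with hα
  set β := Real.log ((1 - Q) / (1 - p)) with hβ
  have hgap : 0 ≤ ((n : ℝ) - ((n + m : ℕ) : ℝ) * Q) * (α - β) := by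
    rcases hy with rfl | rfl
    · have h1 : (n : ℝ) ≤ Q * ((n + m : ℕ) : ℝ) := by
        rw [← div_le_iff₀ hN]; linarith
      have h2 : α ≤ 0 := Real.log_nonpos (by positivity) (by rw [div_le_one hp0]; linarith)
      have h3 : 0 ≤ β := Real.log_nonneg (by rw [le_div_iff₀ hp1']; linarith)
      exact mul_nonneg_of_nonpos_of_nonpos (by linarith) (by linarith)
    · have h1 : Q * ((n + m : ℕ) : ℝ) ≤ n := by
        rw [← le_div_iff₀ hN]; linarith
      have h2 : 0 ≤ α := Real.log_nonneg (by rw [le_div_iff₀ hp0]; linarith)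
      have h3 : β ≤ 0 := Real.log_nonpos (div_nonneg (by linarith) hp1'.le)
        (by rw [div_le_one hp1']; linarith)
      exact mul_nonneg (by linarith) (by linarith)
  have hMN : (M : ℝ) ≤ ((n + m : ℕ) : ℝ) := by exact_mod_cast hMn
  have := mul_le_mul_of_nonneg_right hMN hkl
  refine this.trans ?_
  push_cast at hgap ⊢
  linarith

theorem expNegE_inv_le_ofReal_exp (M : ℕ) (s : ℝ) :
    (expNegE (((M : ℝ) : EReal) * (s : EReal)))⁻¹ ≤ ENNReal.ofReal (Real.exp (M * s)) := by
  rw [← EReal.coe_mul, expNegE, if_neg (EReal.coe_ne_top _), EReal.toReal_coe,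
    ← ENNReal.ofReal_inv_of_pos (Real.exp_pos _), Real.exp_neg, inv_inv]

theorem expNegE_ne_top (e : EReal) : expNegE e ≠ ⊤ := by
  rw [expNegE]
  split_ifs <;> simp

theorem exists_chernoff_weights {p Q y : ℝ} (hp0 : 0 ≤ p) (hp1 : p ≤ 1) (hQ0 : 0 ≤ Q)
    (hQ1 : Q ≤ 1) (hy : y = 1 ∨ y = -1) (hQy : Q * y ≤ p * y) (M : ℕ) :
    ∃ a b : ℝ≥0∞, ENNReal.ofReal p * a + ENNReal.ofReal (1 - p) * b ≤ 1 ∧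
      ∀ n m : ℕ, M ≤ n + m → (n : ℝ) / ((n + m : ℕ) : ℝ) * y ≤ Q * y →
        (expNegE (((M : ℝ) : EReal) * klBern Q p))⁻¹ ≤ a ^ n * b ^ m := by
  have hone : ENNReal.ofReal p * 1 + ENNReal.ofReal (1 - p) * 1 ≤ 1 := by
    rw [mul_one, mul_one, ← ENNReal.ofReal_add hp0 (by linarith)]
    simp
  rcases eq_or_ne M 0 with rfl | hM
  · exact ⟨1, 1, hone, fun n m _ _ => by simp [expNegE]⟩
  rcases hp0.eq_or_lt with rfl | hp0
  · rcases hQ0.eq_or_lt with rfl | hQ0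
    · exact ⟨1, 1, hone, fun n m _ _ => by simp [expNegE, klBern]⟩
    · refine ⟨⊤, 1, by simp, fun n m hMn he => ?_⟩
      have hn : n ≠ 0 := by
        rintro rfl
        rcases hy with rfl | rfl
        · linarith
        · norm_num at he
          linarith
      simp [hn]
  rcases hp1.eq_or_lt with rfl | hp1
  · rcases hQ1.eq_or_lt with rfl | hQ1
    · exact ⟨1, 1, hone, fun n m _ _ => by simp [expNegE, klBern]⟩
    · refine ⟨1, ⊤, by simp, fun n m hMn he => ?_⟩
      have hm : m ≠ 0 := by
        rintro rfl
        have hn : (n : ℝ) ≠ 0 := by exact_mod_cast (by omega)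
        rcases hy with rfl | rfl
        · simp [hn] at he
          linarith
        · linarith
      simp [hm]
  have hp1' : 0 < 1 - p := by linarith
  have ha : 0 ≤ Q / p := by positivity
  have hb : 0 ≤ (1 - Q) / (1 - p) := div_nonneg (by linarith) hp1'.le
  refine ⟨ENNReal.ofReal (Q / p), ENNReal.ofReal ((1 - Q) / (1 - p)), ?_, fun n m hMn he => ?_⟩
  · rw [← ENNReal.ofReal_mul hp0.le, ← ENNReal.ofReal_mul hp1'.le, mul_div_cancel₀ _ hp0.ne',
      mul_div_cancel₀ _ hp1'.ne', ← ENNReal.ofReal_add hQ0 (by linarith)]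
    simp
  · have hfin : klBern Q p =
        ((Q * Real.log (Q / p) + (1 - Q) * Real.log ((1 - Q) / (1 - p)) : ℝ) : EReal) := by
      rw [klBern, if_pos]
      intro c hc
      cases c <;> simp at hc <;> linarith
    rw [hfin, ← ENNReal.ofReal_pow ha, ← ENNReal.ofReal_pow hb,
      ← ENNReal.ofReal_mul (pow_nonneg ha n)]
    exact (expNegE_inv_le_ofReal_exp M _).trans <| ENNReal.ofReal_le_ofReal <|
      exp_mul_kl_le_likelihood hp0 hp1 hQ0 hQ1 hy hQy hM hMn he

/-- Weights whose mean under `PcondT P r x` is at most one satisfy the hypothesis of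
`sum_mul_prod_rewardWeight_le`. -/
theorem ofReal_mul_add_tail_mul_le {X : Type*} [Fintype X] [Nonempty X] [DecidableEq X] {k : ℕ}
    [NeZero k] {P : Fin k → X → ℝ} (hP0 : ∀ r x, 0 ≤ P r x) (r : Fin k) (x : X) {a b : ℝ≥0∞}
    (h : ENNReal.ofReal (PcondT P r x) * a + ENNReal.ofReal (1 - PcondT P r x) * b ≤ 1) :
    ENNReal.ofReal (P r x) * a + (∑ j, if r < j then ENNReal.ofReal (P j x) else 0) * b ≤
      ∑ j, if r ≤ j then ENNReal.ofReal (P j x) else 0 := by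
  set S := ∑ j, if r ≤ j then P j x else 0 with hS
  have hS0 : 0 ≤ S := Finset.sum_nonneg fun j _ => by split_ifs <;> simp [hP0]
  have hsplit : S = P r x + ∑ j, if r < j then P j x else 0 := by
    have : P r x = ∑ j, if r = j then P j x else 0 := by simp
    rw [this, ← Finset.sum_add_distrib]
    refine Finset.sum_congr rfl fun j _ => ?_
    rcases lt_trichotomy r j with h | h | h
    · simp [h, h.ne, h.le]
    · simp [h]
    · simp [h.ne', h.not_gt, h.not_ge]
  have htail0 : 0 ≤ ∑ j, if r < j then P j x else 0 :=
    Finset.sum_nonneg fun j _ => by split_ifs <;> simp [hP0]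
  have hcond : PcondT P r x = P r x / S := by
    rw [PcondT, hS, Finset.sum_filter]
  have hP : P r x = PcondT P r x * S := by
    rw [hcond]
    rcases hS0.eq_or_lt with h0 | h0
    · have := hP0 r x
      rw [← h0]
      linarith
    · rw [div_mul_cancel₀ _ h0.ne']
  have htail : (∑ j, if r < j then P j x else 0) = (1 - PcondT P r x) * S := by linarith
  have hcast : ∀ (p : Fin k → Prop) [DecidablePred p],
      (∑ j, if p j then ENNReal.ofReal (P j x) else 0) =
        ENNReal.ofReal (∑ j, if p j then P j x else 0) := by
    intro p _
    rw [ENNReal.ofReal_sum_of_nonneg fun j _ => by split_ifs <;> simp [hP0]]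
    exact Finset.sum_congr rfl fun j _ => by split_ifs <;> simp
  rw [hcast, hcast, htail, ← hS, hP, ENNReal.ofReal_mul' hS0, ENNReal.ofReal_mul' hS0]
  calc _ = (ENNReal.ofReal (PcondT P r x) * a + ENNReal.ofReal (1 - PcondT P r x) * b) *
          ENNReal.ofReal S := by ring
    _ ≤ _ := mul_le_of_le_one_left' h

theorem PcondT_mem_Icc {X : Type*} [Fintype X] [Nonempty X] [DecidableEq X] {k : ℕ}
    [NeZero k] {P : Fin k → X → ℝ} (hP0 : ∀ r x, 0 ≤ P r x) (r : Fin k) (x : X) :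
    0 ≤ PcondT P r x ∧ PcondT P r x ≤ 1 :=
  ⟨div_nonneg (hP0 r x) (Finset.sum_nonneg fun j _ => hP0 j x),
    div_le_one_of_le₀ (Finset.single_le_sum (f := fun j => P j x) (fun j _ => hP0 j x) (by simp))
      (Finset.sum_nonneg fun j _ => hP0 j x)⟩

/-- deviation bound via conditional Chernoff bounds: with rewards in
`{1,…,k}` (encoded by `Fin k`, `i ↦ i+1`), numbers `N̄′(r,x) ∈ {0,…,t}`, signs
`y(r,x) ∈ {−1,+1}`, `η > 0` and targets `Q′(r,x) ∈ [0,1]` with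
`Q′(r,x)·y(r,x) ≤ P′(r,x)·y(r,x)` (for `r` among the first `k−1` rewards), the event
`B ∩ C` has probability at most `Π_x Π_r exp(−N̄′(r,x)·I_B(Q′(r,x), P′(r,x)))`. -/
theorem deviation_bound
    {X : Type*} [Fintype X] [Nonempty X] [DecidableEq X]
    (k : ℕ) [NeZero k] (t : ℕ)
    (P : Fin k → X → ℝ) (hP0 : ∀ r x, 0 ≤ P r x) (hP1 : ∀ x, ∑ r : Fin k, P r x = 1)
    (π : List (X × Fin k) → X)
    (Nbar : Fin k → X → ℕ) (hNbar : ∀ r x, Nbar r x ≤ t)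
    (y : Fin k → X → ℝ) (hy : ∀ r x, y r x = 1 ∨ y r x = -1)
    (η : ℝ) (hη : 0 < η)
    (Q' : Fin k → X → ℝ) (hQ' : ∀ r x, 0 ≤ Q' r x ∧ Q' r x ≤ 1)
    (hQ'y : ∀ x : X, ∀ r : Fin k, (r : ℕ) + 1 < k →
      Q' r x * y r x ≤ PcondT P r x * y r x) :
    tableMeasure P t
        ({ω : Fin t → X → Fin k | ∀ x : X, ∀ r : Fin k, (r : ℕ) + 1 < k →
            Nbar r x ≤ pullsGeT π ω t r x ∧
              (pullsGeT π ω t r x : ℝ) ≤ (1 + η) * (Nbar r x : ℝ)} ∩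
         {ω : Fin t → X → Fin k | ∀ x : X, ∀ r : Fin k, (r : ℕ) + 1 < k →
            PcondEmpT π ω t r x * y r x ≤ Q' r x * y r x}) ≤
      ∏ x : X, ∏ r ∈ Finset.univ.filter (fun r : Fin k => (r : ℕ) + 1 < k),
        expNegE (((Nbar r x : ℝ) : EReal) * klBern (Q' r x) (PcondT P r x)) := by
  have hw : ∀ x r, ∃ a b : ℝ≥0∞,
      ENNReal.ofReal (PcondT P r x) * a + ENNReal.ofReal (1 - PcondT P r x) * b ≤ 1 ∧
      ((r : ℕ) + 1 < k → ∀ n m : ℕ, Nbar r x ≤ n + m →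
        (n : ℝ) / ((n + m : ℕ) : ℝ) * y r x ≤ Q' r x * y r x →
        (expNegE (((Nbar r x : ℝ) : EReal) * klBern (Q' r x) (PcondT P r x)))⁻¹ ≤
          a ^ n * b ^ m) ∧ (¬ (r : ℕ) + 1 < k → a = 1 ∧ b = 1) := by
    intro x r
    obtain ⟨hp0, hp1⟩ := PcondT_mem_Icc hP0 r x
    by_cases hr : (r : ℕ) + 1 < k
    · obtain ⟨a, b, h1, h2⟩ := exists_chernoff_weights hp0 hp1 (hQ' r x).1 (hQ' r x).2 (hy r x)
        (hQ'y x r hr) (Nbar r x)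
      exact ⟨a, b, h1, fun _ => h2, fun h => absurd hr h⟩
    · refine ⟨1, 1, ?_, fun h => absurd h hr, fun _ => ⟨rfl, rfl⟩⟩
      rw [mul_one, mul_one, ← ENNReal.ofReal_add hp0 (by linarith)]
      simp
  choose a b hab hbound hlast using hw
  have hmass : ∀ x, ∑ j, ENNReal.ofReal (P j x) = 1 := fun x => by
    rw [← ENNReal.ofReal_sum_of_nonneg fun j _ => hP0 j x, hP1, ENNReal.ofReal_one]
  have hmean := sum_table_mul_prod_histT_le (fun r x => ENNReal.ofReal (P r x)) hmass
    (fun p => ∏ r, rewardWeight (a p.1) (b p.1) p.2 r)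
    (fun x => (sum_mul_prod_rewardWeight_le (fun r => ENNReal.ofReal (P r x)) (a x) (b x)
      fun r => ofReal_mul_add_tail_mul_le hP0 r x (hab x r)).trans_eq (hmass x)) t (t - 1) π
  set E : Set (Fin t → X → Fin k) := _ ∩ _
  set c : Fin k → X → ℝ≥0∞ := fun r x =>
    expNegE (((Nbar r x : ℝ) : EReal) * klBern (Q' r x) (PcondT P r x)) with hc
  set C := ∏ x : X, ∏ r ∈ Finset.univ.filter (fun r : Fin k => (r : ℕ) + 1 < k), c r x with hC
  have hCinv : C⁻¹ =
      ∏ x : X, ∏ r ∈ Finset.univ.filter (fun r : Fin k => (r : ℕ) + 1 < k), (c r x)⁻¹ := by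
    have hfin : ∀ x, ∏ r ∈ Finset.univ.filter (fun r : Fin k => (r : ℕ) + 1 < k), c r x ≠ ⊤ :=
      fun x => ENNReal.prod_ne_top fun r _ => expNegE_ne_top _
    rw [hC, ENNReal.prod_inv_distrib fun x _ x' _ _ => Or.inr (hfin x')]
    exact Finset.prod_congr rfl fun x _ =>
      ENNReal.prod_inv_distrib fun r _ r' _ _ => Or.inr (expNegE_ne_top _)
  have hlarge : ∀ ω ∈ E, C⁻¹ ≤
      ((histT π ω (t - 1)).map fun p => ∏ r, rewardWeight (a p.1) (b p.1) p.2 r).prod := by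
    intro ω hω
    rw [prod_map_rewardWeight, hCinv]
    refine Finset.prod_le_prod' fun x _ => ?_
    rw [Finset.prod_filter]
    refine Finset.prod_le_prod' fun r _ => ?_
    split_ifs with hr
    · have hge : pullsGeT π ω t r x = _ := length_filter_ge (histT π ω (t - 1)) x r
      have h1 := (hω.1 x r hr).1
      have h2 := hω.2 x r hr
      rw [PcondEmpT] at h2
      rw [hge] at h1 h2
      exact hbound x r hr _ _ h1 h2
    · simp [hlast x r hr]
  have hmarkov : tableMeasure P t E * C⁻¹ ≤ 1 := by
    rw [tableMeasure_apply, Finset.sum_mul]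
    refine le_trans (Finset.sum_le_sum fun ω _ => ?_) hmean
    rw [mul_assoc]
    gcongr
    by_cases hω : ω ∈ E
    · simpa [hω] using hlarge ω hω
    · simp [hω]
  simpa using ENNReal.le_inv_iff_mul_le.2 hmarkov

end Bandit
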